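/- Assume J = 0, W = [[e^{h_A}, e^{h_AB}], [e^{h_AB}, e^{h_B}]] positive definite, and α ∈ (0,1) ∩ ℚ. Then the limit as N → ∞ (along N with αN ∈ ℕ) of (1/N)·log Z_N exists and equals sup_N (1/N)·log Z*_N. -/

import Mathlib

noncomputable section
open Real Matrix MeasureTheory Filter Topology

/-- A monomer-dimer configuration: a set of non-degenerate pairwise disjoint edges. -/
def IsMDConfig (N : ℕ) (Δ : Finset (Sym2 (Fin N))) : Prop :=
  (∀ e ∈ Δ, ¬ e.IsDiag) ∧
    ∀ e ∈ Δ, ∀ e' ∈ Δ, e ≠ e' → ∀ v : Fin N, v ∈ e → v ∉ e'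

open scoped Classical in
/-- All monomer-dimer configurations on `N` sites. -/
def mdConfigs (N : ℕ) : Finset (Finset (Sym2 (Fin N))) :=
  Finset.univ.filter fun Δ => IsMDConfig N Δ

open scoped Classical in
/-- Number of dimers internal to population A (sites with index < N_A). -/
def countA (N NA : ℕ) (Δ : Finset (Sym2 (Fin N))) : ℕ :=
  (Δ.filter fun e => ∀ v : Fin N, v ∈ e → (v : ℕ) < NA).card

open scoped Classical in
/-- Number of dimers internal to population B (sites with index ≥ N_A). -/
def countB (N NA : ℕ) (Δ : Finset (Sym2 (Fin N))) : ℕ :=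
  (Δ.filter fun e => ∀ v : Fin N, v ∈ e → NA ≤ (v : ℕ)).card

open scoped Classical in
/-- Number of mixed dimers. -/
def countAB (N NA : ℕ) (Δ : Finset (Sym2 (Fin N))) : ℕ :=
  (Δ.filter fun e =>
    (∃ v : Fin N, v ∈ e ∧ (v : ℕ) < NA) ∧ ∃ v : Fin N, v ∈ e ∧ NA ≤ (v : ℕ)).card

/-- Partition function at J = 0, with dimer activities w_A = e^{h_A}, w_B = e^{h_B},
w_AB = e^{h_AB}. -/
def mdZ0 (N NA : ℕ) (hA hB hAB : ℝ) : ℝ :=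
  ∑ Δ ∈ mdConfigs N,
    (Real.exp hA / N) ^ countA N NA Δ * (Real.exp hB / N) ^ countB N NA Δ *
      (Real.exp hAB / N) ^ countAB N NA Δ

/-- The covariance matrix W. -/
def covW (hA hB hAB : ℝ) : Matrix (Fin 2) (Fin 2) ℝ :=
  !![Real.exp hA, Real.exp hAB; Real.exp hAB, Real.exp hB]

/-- Density of a centred Gaussian vector on ℝ² with covariance matrix `S`. -/
def gaussDensity (S : Matrix (Fin 2) (Fin 2) ℝ) (x : Fin 2 → ℝ) : ℝ :=
  (2 * Real.pi)⁻¹ * (Real.sqrt S.det)⁻¹ *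
    Real.exp (-(1 / 2) * (S⁻¹.mulVec x ⬝ᵥ x))

/-- The modified partition function Z*: the Gaussian expectation restricted to
`Q = {ξ : 1 + ξ_A > 0, 1 + ξ_B > 0}`, for populations of sizes `MA`, `MB` and
covariance `W / (MA + MB)`. -/
def Zstar (MA MB : ℕ) (hA hB hAB : ℝ) : ℝ :=
  ∫ x : Fin 2 → ℝ in {x | -1 < x 0 ∧ -1 < x 1},
    (1 + x 0) ^ MA * (1 + x 1) ^ MB *
      gaussDensity (((MA + MB : ℕ) : ℝ)⁻¹ • covW hA hB hAB) x


open scoped Classical in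
def mdF (N : ℕ) (S : Finset (Fin N)) : Finset (Finset (Sym2 (Fin N))) :=
  Finset.univ.filter fun Δ => IsMDConfig N Δ ∧ ∀ e ∈ Δ, ∀ v ∈ e, v ∈ S

def mdS (N : ℕ) (w : Sym2 (Fin N) → ℝ) (S : Finset (Fin N)) : ℝ :=
  ∑ Δ ∈ mdF N S, ∏ e ∈ Δ, w e

lemma mem_mdF {N : ℕ} {S : Finset (Fin N)} {Δ : Finset (Sym2 (Fin N))} :
    Δ ∈ mdF N S ↔ IsMDConfig N Δ ∧ ∀ e ∈ Δ, ∀ v ∈ e, v ∈ S := by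
  simp [mdF]

lemma mdS_empty (N : ℕ) (w : Sym2 (Fin N) → ℝ) : mdS N w ∅ = 1 := by
  have : mdF N ∅ = {∅} := by
    ext Δ
    rw [mem_mdF, Finset.mem_singleton]
    constructor
    · rintro ⟨-, h⟩
      by_contra hne
      obtain ⟨e, he⟩ := Finset.nonempty_iff_ne_empty.mpr hne
      induction e using Sym2.ind with
      | _ x y => exact absurd (h _ he x (by simp)) (by simp)
    · rintro rfl
      simp [IsMDConfig]
  simp [mdS, this]

lemma mdS_insert (N : ℕ) (w : Sym2 (Fin N) → ℝ) (S : Finset (Fin N)) (v : Fin N) (hv : v ∉ S) :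
    mdS N w (insert v S) = mdS N w S + ∑ u ∈ S, w s(u, v) * mdS N w (S.erase u) := by
  classical
  unfold mdS
  rw [← Finset.sum_filter_add_sum_filter_not (mdF N (insert v S)) (fun Δ => ∀ e ∈ Δ, v ∉ e)]
  congr 1
  · apply Finset.sum_congr _ (fun _ _ => rfl)
    ext Δ
    simp only [Finset.mem_filter, mem_mdF]
    constructor
    · rintro ⟨⟨h1, h2⟩, h3⟩
      refine ⟨h1, fun e he x hx => ?_⟩
      rcases Finset.mem_insert.mp (h2 e he x hx) with rfl | h
      · exact absurd hx (h3 e he)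
      · exact h
    · rintro ⟨h1, h2⟩
      exact ⟨⟨h1, fun e he x hx => Finset.mem_insert_of_mem (h2 e he x hx)⟩,
        fun e he hx => hv (h2 e he v hx)⟩
  · simp_rw [Finset.mul_sum]
    rw [Finset.sum_sigma']
    symm
    refine Finset.sum_bij (fun p _ => insert s(p.1, v) p.2) ?_ ?_ ?_ ?_
    · rintro ⟨u, Δ⟩ h
      simp only [Finset.mem_sigma, mem_mdF, Finset.mem_filter] at h ⊢
      obtain ⟨hu, ⟨h1, h1'⟩, h2⟩ := h
      have huv : u ≠ v := fun h => hv (h ▸ hu)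
      refine ⟨⟨⟨?_, ?_⟩, ?_⟩, ?_⟩
      · intro e he
        rcases Finset.mem_insert.mp he with rfl | he
        · simpa using huv
        · exact h1 e he
      · intro e he e' he' hne x hx hx'
        rcases Finset.mem_insert.mp he with rfl | he <;>
        rcases Finset.mem_insert.mp he' with rfl | he'
        · exact hne rfl
        · have := h2 e' he' x hx'
          rcases Sym2.mem_iff.mp hx with rfl | rfl
          · simp at this
          · exact hv (Finset.mem_of_mem_erase this)
        · have := h2 e he x hx
          rcases Sym2.mem_iff.mp hx' with rfl | rfl
          · simp at this
          · exact hv (Finset.mem_of_mem_erase this)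
        · exact h1' e he e' he' hne x hx hx'
      · intro e he x hx
        rcases Finset.mem_insert.mp he with rfl | he
        · rcases Sym2.mem_iff.mp hx with rfl | rfl
          · exact Finset.mem_insert_of_mem hu
          · simp
        · exact Finset.mem_insert_of_mem (Finset.mem_of_mem_erase (h2 e he x hx))
      · intro h
        exact h s(u, v) (by simp) (by simp)
    · rintro ⟨u, Δ⟩ h ⟨u', Δ'⟩ h' heq
      simp only [Finset.mem_sigma, mem_mdF] at h h' heq
      have n1 : s(u, v) ∉ Δ := fun hh => hv (Finset.mem_of_mem_erase (h.2.2 _ hh v (by simp)))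
      have n2 : s(u', v) ∉ Δ' := fun hh => hv (Finset.mem_of_mem_erase (h'.2.2 _ hh v (by simp)))
      have n3 : s(u, v) ∉ Δ' := fun hh => hv (Finset.mem_of_mem_erase (h'.2.2 _ hh v (by simp)))
      have : s(u, v) ∈ insert s(u', v) Δ' := heq ▸ Finset.mem_insert_self _ _
      have e1 : s(u, v) = s(u', v) := (Finset.mem_insert.mp this).resolve_right n3
      have e2 : u = u' := Sym2.congr_left.mp e1
      subst e2
      have : Δ = Δ' := by
        rw [← Finset.erase_insert n1, heq, Finset.erase_insert n2]
      rw [this]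
    · intro Δ h
      simp only [Finset.mem_filter, mem_mdF] at h
      obtain ⟨⟨⟨h1, h1'⟩, h2⟩, h3⟩ := h
      push Not at h3
      obtain ⟨e, he, hve⟩ := h3
      obtain ⟨u, rfl⟩ := Sym2.mem_iff_exists.mp hve
      rw [Sym2.eq_swap] at he
      have huv : u ≠ v := by simpa using h1 _ he
      have huS : u ∈ S := Finset.mem_of_mem_insert_of_ne (h2 _ he u (by simp)) huv
      refine ⟨⟨u, Δ.erase s(u, v)⟩, ?_, Finset.insert_erase he⟩
      simp only [Finset.mem_sigma, mem_mdF]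
      refine ⟨huS, ⟨fun e h => h1 e (Finset.mem_of_mem_erase h), fun e h e' h' =>
        h1' e (Finset.mem_of_mem_erase h) e' (Finset.mem_of_mem_erase h')⟩, ?_⟩
      intro e h x hx
      obtain ⟨hne, h⟩ := Finset.mem_erase.mp h
      have hx1 := h1' e h _ he hne x hx
      have hxu : x ≠ u := fun hh => hx1 (by simp [hh])
      have hxv : x ≠ v := fun hh => hx1 (by simp [hh])
      exact Finset.mem_erase.mpr ⟨hxu, Finset.mem_of_mem_insert_of_ne (h2 e h x hx) hxv⟩
    · rintro ⟨u, Δ⟩ h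
      simp only [Finset.mem_sigma, mem_mdF] at h
      have n1 : s(u, v) ∉ Δ := fun hh => hv (Finset.mem_of_mem_erase (h.2.2 _ hh v (by simp)))
      rw [Finset.prod_insert n1]

def mdw (N NA : ℕ) (a b c : ℝ) : Sym2 (Fin N) → ℝ :=
  Sym2.lift ⟨fun u v => if (u : ℕ) < NA then (if (v : ℕ) < NA then a else c)
    else (if (v : ℕ) < NA then c else b), fun u v => by
      by_cases h : (u : ℕ) < NA <;> by_cases h' : (v : ℕ) < NA <;> simp [h, h']⟩

lemma mdZ0_eq (N NA : ℕ) (hA hB hAB : ℝ) :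
    mdZ0 N NA hA hB hAB = mdS N (mdw N NA (Real.exp hA / N) (Real.exp hB / N) (Real.exp hAB / N))
      Finset.univ := by
  classical
  unfold mdZ0 mdS
  apply Finset.sum_congr
  · ext Δ
    simp [mdConfigs, mdF]
  · intro Δ _
    unfold countA countB countAB
    rw [← Finset.prod_const, ← Finset.prod_const, ← Finset.prod_const,
      Finset.prod_filter, Finset.prod_filter, Finset.prod_filter,
      ← Finset.prod_mul_distrib, ← Finset.prod_mul_distrib]
    apply Finset.prod_congr rfl
    intro e _
    induction e using Sym2.ind with
    | _ x y =>
      by_cases h : (x : ℕ) < NA <;> by_cases h' : (y : ℕ) < NA <;>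
        simp [mdw, h, h', not_le.mpr, not_lt.mp]

/-- Reciprocal factorial on the integers. -/
def rfac (z : ℤ) : ℝ := if 0 ≤ z then ((z.toNat.factorial : ℕ) : ℝ)⁻¹ else 0

lemma rfac_neg {z : ℤ} (h : z < 0) : rfac z = 0 := by simp [rfac, h]

lemma rfac_nat (n : ℕ) : rfac n = ((n.factorial : ℕ) : ℝ)⁻¹ := by simp [rfac]

lemma rfac_nonneg (z : ℤ) : 0 ≤ rfac z := by
  unfold rfac; split_ifs <;> positivity

lemma mul_rfac (z : ℤ) : (z : ℝ) * rfac z = rfac (z - 1) := by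
  rcases lt_trichotomy z 0 with h | h | h
  · rw [rfac_neg h, rfac_neg (by omega)]; simp
  · subst h; rw [rfac_neg (z := 0 - 1) (by omega)]; simp
  · obtain ⟨n, rfl⟩ : ∃ n : ℕ, z = n + 1 := ⟨(z - 1).toNat, by omega⟩
    rw [add_sub_cancel_right, rfac_nat, ← Nat.cast_succ, rfac_nat, Nat.factorial_succ]
    push_cast
    have : ((n.factorial : ℕ) : ℝ) ≠ 0 := by positivity
    field_simp

lemma shift_sum (A : ℝ) (L : ℕ) (H : ℕ → ℝ) (hL : H L = 0) :
    ∑ i ∈ Finset.range L, (i : ℝ) * (A ^ i / (i.factorial : ℕ)) * H i =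
      A * ∑ i ∈ Finset.range L, (A ^ i / (i.factorial : ℕ)) * H (i + 1) := by
  have h1 := Finset.sum_range_succ (fun i : ℕ => (i : ℝ) * (A ^ i / (i.factorial : ℕ)) * H i) L
  rw [Finset.sum_range_succ'] at h1
  simp only [hL, mul_zero, add_zero, Nat.cast_zero, zero_mul] at h1
  rw [← h1, Finset.mul_sum]
  apply Finset.sum_congr rfl
  intro i _
  rw [Nat.factorial_succ, pow_succ]
  have : ((i.factorial : ℕ) : ℝ) ≠ 0 := by positivity
  push_cast
  field_simp

def trm (A B C : ℝ) (n m : ℤ) (i j k : ℕ) : ℝ :=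
  (A ^ i / (i.factorial : ℕ)) * (B ^ j / (j.factorial : ℕ)) * (C ^ k / (k.factorial : ℕ)) *
    rfac (n - 2 * i - k) * rfac (m - 2 * j - k)

def UU (L : ℕ) (A B C : ℝ) (n m : ℤ) : ℝ :=
  ∑ i ∈ Finset.range L, ∑ j ∈ Finset.range L, ∑ k ∈ Finset.range L, trm A B C n m i j k

lemma trm_nonneg {A B C : ℝ} (hA : 0 ≤ A) (hB : 0 ≤ B) (hC : 0 ≤ C) (n m : ℤ) (i j k : ℕ) :
    0 ≤ trm A B C n m i j k := by
  unfold trm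
  have := rfac_nonneg (n - 2 * i - k)
  have := rfac_nonneg (m - 2 * j - k)
  positivity

lemma UU_symm (L : ℕ) (A B C : ℝ) (n m : ℤ) : UU L A B C n m = UU L B A C m n := by
  unfold UU
  rw [Finset.sum_comm]
  refine Finset.sum_congr rfl fun i _ => Finset.sum_congr rfl fun j _ =>
    Finset.sum_congr rfl fun k _ => ?_
  unfold trm
  ring

lemma UU_neg (L : ℕ) (A B C : ℝ) (n m : ℤ) (h : n < 0) : UU L A B C n m = 0 := by
  unfold UU
  refine Finset.sum_eq_zero fun i _ => Finset.sum_eq_zero fun j _ =>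
    Finset.sum_eq_zero fun k _ => ?_
  unfold trm
  rw [rfac_neg (z := n - 2 * i - k) (by omega)]
  simp

lemma UU_zero (L : ℕ) (hL : 0 < L) (A B C : ℝ) : UU L A B C 0 0 = 1 := by
  unfold UU
  rw [Finset.sum_eq_single_of_mem 0 (by simpa using hL),
    Finset.sum_eq_single_of_mem 0 (by simpa using hL),
    Finset.sum_eq_single_of_mem 0 (by simpa using hL)]
  · simp [trm, rfac]
  · intro k _ hk
    unfold trm
    rw [rfac_neg (z := 0 - 2 * ((0 : ℕ) : ℤ) - k) (by omega)]
    simp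
  · intro j _ hj
    refine Finset.sum_eq_zero fun k _ => ?_
    unfold trm
    rw [rfac_neg (z := 0 - 2 * (j : ℤ) - k) (by omega)]
    simp
  · intro j _ hj
    refine Finset.sum_eq_zero fun i _ => Finset.sum_eq_zero fun k _ => ?_
    unfold trm
    rw [rfac_neg (z := 0 - 2 * (j : ℤ) - k) (by omega)]
    simp

lemma UU_rec (L : ℕ) (A B C : ℝ) (n m : ℤ) (hn : n < L) :
    (n : ℝ) * UU L A B C n m = UU L A B C (n - 1) m + 2 * A * UU L A B C (n - 2) m +
      C * UU L A B C (n - 1) (m - 1) := by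
  have hsplit : ∀ i j k : ℕ, (n : ℝ) * trm A B C n m i j k = trm A B C (n - 1) m i j k +
      2 * ((i : ℝ) * trm A B C n m i j k) + (k : ℝ) * trm A B C n m i j k := by
    intro i j k
    have h := mul_rfac (n - 2 * i - k)
    have h2 : n - 2 * (i : ℤ) - k - 1 = n - 1 - 2 * i - k := by ring
    rw [h2] at h
    push_cast at h
    have : trm A B C (n - 1) m i j k = ((n : ℝ) - 2 * i - k) * trm A B C n m i j k := by
      unfold trm
      rw [← h]
      ring
    rw [this]
    ring
  have e1 : ∑ i ∈ Finset.range L, ∑ j ∈ Finset.range L, ∑ k ∈ Finset.range L,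
      (i : ℝ) * trm A B C n m i j k = A * UU L A B C (n - 2) m := by
    have h := shift_sum A L (fun i => ∑ j ∈ Finset.range L, ∑ k ∈ Finset.range L,
      (B ^ j / (j.factorial : ℕ)) * (C ^ k / (k.factorial : ℕ)) *
        rfac (n - 2 * i - k) * rfac (m - 2 * j - k)) (by
        refine Finset.sum_eq_zero fun j _ => Finset.sum_eq_zero fun k _ => ?_
        rw [rfac_neg (z := n - 2 * L - k) (by omega)]
        simp)
    unfold UU trm
    simp only [Finset.mul_sum] at h ⊢
    convert h using 1
    · refine Finset.sum_congr rfl fun i _ => Finset.sum_congr rfl fun j _ =>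
        Finset.sum_congr rfl fun k _ => ?_
      ring
    · refine Finset.sum_congr rfl fun i _ => Finset.sum_congr rfl fun j _ =>
        Finset.sum_congr rfl fun k _ => ?_
      have : n - 2 * ((i + 1 : ℕ) : ℤ) - k = n - 2 - 2 * i - k := by push_cast; ring
      rw [this]
      ring
  have e2 : ∑ i ∈ Finset.range L, ∑ j ∈ Finset.range L, ∑ k ∈ Finset.range L,
      (k : ℝ) * trm A B C n m i j k = C * UU L A B C (n - 1) (m - 1) := by
    unfold UU
    simp only [Finset.mul_sum]
    refine Finset.sum_congr rfl fun i _ => Finset.sum_congr rfl fun j _ => ?_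
    have h := shift_sum C L (fun k =>
      (A ^ i / (i.factorial : ℕ)) * (B ^ j / (j.factorial : ℕ)) *
        rfac (n - 2 * i - k) * rfac (m - 2 * j - k)) (by
        rw [rfac_neg (z := n - 2 * i - L) (by omega)]
        simp)
    unfold trm
    simp only [Finset.mul_sum] at h ⊢
    convert h using 1
    · refine Finset.sum_congr rfl fun k _ => ?_
      ring
    · refine Finset.sum_congr rfl fun k _ => ?_
      have : n - 2 * (i : ℤ) - (k + 1 : ℕ) = n - 1 - 2 * i - k := by push_cast; ring
      rw [this]
      have : m - 2 * (j : ℤ) - (k + 1 : ℕ) = m - 1 - 2 * j - k := by push_cast; ring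
      rw [this]
      ring
  have e3 : (n : ℝ) * UU L A B C n m = UU L A B C (n - 1) m +
      2 * (∑ i ∈ Finset.range L, ∑ j ∈ Finset.range L, ∑ k ∈ Finset.range L,
        (i : ℝ) * trm A B C n m i j k) +
      ∑ i ∈ Finset.range L, ∑ j ∈ Finset.range L, ∑ k ∈ Finset.range L,
        (k : ℝ) * trm A B C n m i j k := by
    unfold UU
    simp only [Finset.mul_sum, hsplit, Finset.sum_add_distrib]
  rw [e3, e1, e2]
  ring

lemma trm_le {A B C r s : ℝ} (hA : 0 ≤ A) (hB : 0 ≤ B) (hC : 0 ≤ C) (hr : 0 < r) (hs : 0 < s)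
    (n m : ℕ) (i j k : ℕ) :
    trm A B C n m i j k * (r ^ n * s ^ m) ≤
      Real.exp (r + s + A * r ^ 2 + B * s ^ 2 + C * (r * s)) := by
  by_cases h1 : 2 * i + k ≤ n
  · by_cases h2 : 2 * j + k ≤ m
    · obtain ⟨p, rfl⟩ := Nat.exists_eq_add_of_le h1
      obtain ⟨q, rfl⟩ := Nat.exists_eq_add_of_le h2
      have e : trm A B C (2 * i + k + p : ℕ) (2 * j + k + q : ℕ) i j k *
          (r ^ (2 * i + k + p) * s ^ (2 * j + k + q)) =
          (r ^ p / (p.factorial : ℕ)) * (s ^ q / (q.factorial : ℕ)) *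
          ((A * r ^ 2) ^ i / (i.factorial : ℕ)) *
          ((B * s ^ 2) ^ j / (j.factorial : ℕ)) * ((C * (r * s)) ^ k / (k.factorial : ℕ)) := by
        unfold trm
        have a1 : ((2 * i + k + p : ℕ) : ℤ) - 2 * i - k = (p : ℕ) := by push_cast; ring
        have a2 : ((2 * j + k + q : ℕ) : ℤ) - 2 * j - k = (q : ℕ) := by push_cast; ring
        rw [a1, a2, rfac_nat, rfac_nat]
        simp only [mul_pow, pow_add, pow_mul]
        field_simp
      rw [e]
      simp only [Real.exp_add]
      have := Real.pow_div_factorial_le_exp r hr.le p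
      have := Real.pow_div_factorial_le_exp s hs.le q
      have := Real.pow_div_factorial_le_exp (A * r ^ 2) (by positivity) i
      have := Real.pow_div_factorial_le_exp (B * s ^ 2) (by positivity) j
      have := Real.pow_div_factorial_le_exp (C * (r * s)) (by positivity) k
      gcongr
    · unfold trm
      rw [rfac_neg (z := (m : ℤ) - 2 * j - k) (by omega)]
      simpa using (Real.exp_pos _).le
  · unfold trm
    rw [rfac_neg (z := (n : ℤ) - 2 * i - k) (by omega)]
    simpa using (Real.exp_pos _).le

lemma UU_le {A B C r s : ℝ} (hA : 0 ≤ A) (hB : 0 ≤ B) (hC : 0 ≤ C) (hr : 0 < r) (hs : 0 < s)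
    (L n m : ℕ) :
    UU L A B C n m * (r ^ n * s ^ m) ≤ (L : ℝ) ^ 3 *
      Real.exp (r + s + A * r ^ 2 + B * s ^ 2 + C * (r * s)) := by
  unfold UU
  simp only [Finset.sum_mul]
  calc _ ≤ ∑ i ∈ Finset.range L, ∑ j ∈ Finset.range L, ∑ k ∈ Finset.range L,
        Real.exp (r + s + A * r ^ 2 + B * s ^ 2 + C * (r * s)) :=
        Finset.sum_le_sum fun i _ => Finset.sum_le_sum fun j _ => Finset.sum_le_sum fun k _ =>
          trm_le hA hB hC hr hs n m i j k
    _ = _ := by simp; ring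

lemma le_UU {A B C : ℝ} (hA : 0 ≤ A) (hB : 0 ≤ B) (hC : 0 ≤ C) (L : ℕ) (n m : ℤ) (i j k : ℕ)
    (hi : i < L) (hj : j < L) (hk : k < L) :
    trm A B C n m i j k ≤ UU L A B C n m := by
  have hn := trm_nonneg hA hB hC n m
  unfold UU
  calc _ ≤ ∑ k ∈ Finset.range L, trm A B C n m i j k :=
        Finset.single_le_sum (f := fun k => trm A B C n m i j k) (fun k _ => hn i j k)
          (Finset.mem_range.mpr hk)
    _ ≤ ∑ j ∈ Finset.range L, ∑ k ∈ Finset.range L, trm A B C n m i j k :=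
        Finset.single_le_sum (f := fun j => ∑ k ∈ Finset.range L, trm A B C n m i j k)
          (fun j _ => Finset.sum_nonneg fun k _ => hn i j k) (Finset.mem_range.mpr hj)
    _ ≤ _ := Finset.single_le_sum
          (f := fun i => ∑ j ∈ Finset.range L, ∑ k ∈ Finset.range L, trm A B C n m i j k)
          (fun i _ => Finset.sum_nonneg fun j _ => Finset.sum_nonneg fun k _ => hn i j k)
          (Finset.mem_range.mpr hi)

lemma mdw_symm_sum {N NA : ℕ} (a b c : ℝ) (S : Finset (Fin N)) (v : Fin N) (f : Fin N → ℝ)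
    (x y : ℝ)
    (hx : ∀ u ∈ S, (u : ℕ) < NA → f u = x) (hy : ∀ u ∈ S, ¬ (u : ℕ) < NA → f u = y) :
    ∑ u ∈ S, mdw N NA a b c s(u, v) * f u =
      ((S.filter fun u : Fin N => (u : ℕ) < NA).card : ℝ) * ((if (v : ℕ) < NA then a else c) * x) +
      ((S.filter fun u : Fin N => ¬ (u : ℕ) < NA).card : ℝ) * ((if (v : ℕ) < NA then c else b) * y) := by
  rw [← Finset.sum_filter_add_sum_filter_not S (fun u => (u : ℕ) < NA)]
  congr 1
  · rw [← nsmul_eq_mul, ← Finset.sum_const]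
    refine Finset.sum_congr rfl fun u hu => ?_
    rw [Finset.mem_filter] at hu
    rw [hx u hu.1 hu.2]
    simp [mdw, hu.2]
  · rw [← nsmul_eq_mul, ← Finset.sum_const]
    refine Finset.sum_congr rfl fun u hu => ?_
    rw [Finset.mem_filter] at hu
    rw [hy u hu.1 hu.2]
    simp [mdw, hu.2]

lemma mdS_eq (N NA : ℕ) (a b c : ℝ) (L : ℕ) : ∀ (d : ℕ) (S : Finset (Fin N)), S.card = d →
    d < L → ∀ n m : ℕ, (S.filter fun u : Fin N => (u : ℕ) < NA).card = n →
    (S.filter fun u : Fin N => ¬ (u : ℕ) < NA).card = m →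
    mdS N (mdw N NA a b c) S =
      (n.factorial : ℕ) * (m.factorial : ℕ) * UU L (a / 2) (b / 2) c n m := by
  intro d
  induction d using Nat.strong_induction_on with
  | _ d ih =>
  intro S hS hL n m hn hm
  rcases Finset.eq_empty_or_nonempty S with rfl | ⟨v, hvS⟩
  · simp only [Finset.filter_empty, Finset.card_empty] at hn hm
    subst hn hm
    rw [mdS_empty]
    have := UU_zero L (by omega) (a / 2) (b / 2) c
    simpa using this.symm
  obtain ⟨T, hvT, rfl⟩ : ∃ T : Finset (Fin N), v ∉ T ∧ S = insert v T :=
    ⟨S.erase v, by simp, (Finset.insert_erase hvS).symm⟩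
  rw [Finset.card_insert_of_notMem hvT] at hS
  have hnm : n + m = d := by
    rw [← hn, ← hm, Finset.card_filter_add_card_filter_not, Finset.card_insert_of_notMem hvT, hS]
  rw [mdS_insert N _ T v hvT]
  set n' := (T.filter fun u : Fin N => (u : ℕ) < NA).card with hn'
  set m' := (T.filter fun u : Fin N => ¬ (u : ℕ) < NA).card with hm'
  have hT := ih T.card (by omega) T rfl (by omega) n' m' rfl rfl
  have hx : ∀ u ∈ T, (u : ℕ) < NA → mdS N (mdw N NA a b c) (T.erase u) =
      ((n' - 1).factorial : ℕ) * (m'.factorial : ℕ) * UU L (a / 2) (b / 2) c (n' - 1 : ℕ) m' := by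
    intro u hu huA
    have hc := Finset.card_erase_add_one hu
    apply ih (T.erase u).card (by omega) _ rfl (by omega)
    · rw [Finset.filter_erase, Finset.card_erase_of_mem (by simp [hu, huA])]
    · rw [Finset.filter_erase, Finset.erase_eq_of_notMem (by simp [huA])]
  have hy : ∀ u ∈ T, ¬ (u : ℕ) < NA → mdS N (mdw N NA a b c) (T.erase u) =
      (n'.factorial : ℕ) * ((m' - 1).factorial : ℕ) * UU L (a / 2) (b / 2) c n' (m' - 1 : ℕ) := by
    intro u hu huA
    have hc := Finset.card_erase_add_one hu
    apply ih (T.erase u).card (by omega) _ rfl (by omega)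
    · rw [Finset.filter_erase, Finset.erase_eq_of_notMem (by simp [huA])]
    · rw [Finset.filter_erase, Finset.card_erase_of_mem (by simp [hu]; omega)]
  rw [mdw_symm_sum a b c T v _ _ _ hx hy, hT, ← hn', ← hm']
  have f1 : ∀ k : ℕ, ∀ g : ℤ → ℝ, g (-1) = 0 →
      (k : ℝ) * (((k - 1).factorial : ℕ) * g (k - 1 : ℕ)) = (k.factorial : ℕ) * g (k - 1) := by
    intro k g hg
    rcases k with _ | k
    · simp [hg]
    · rw [Nat.factorial_succ]
      push_cast
      simp
      ring
  have g1 := f1 n' (fun z => UU L (a / 2) (b / 2) c z m') (UU_neg _ _ _ _ _ _ (by omega))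
  have g2 := f1 m' (fun z => UU L (a / 2) (b / 2) c n' z)
    (by rw [UU_symm]; exact UU_neg _ _ _ _ _ _ (by omega))
  by_cases hvA : (v : ℕ) < NA
  · simp only [hvA, if_true]
    rw [Finset.filter_insert, if_pos hvA, Finset.card_insert_of_notMem (by simp [hvT]), ← hn'] at hn
    rw [Finset.filter_insert, if_neg (not_not.mpr hvA), ← hm'] at hm
    subst hn hm
    have hr := UU_rec L (a / 2) (b / 2) c (n' + 1) m' (by omega)
    have e : (n' : ℤ) + 1 - 2 = n' - 1 := by ring
    rw [add_sub_cancel_right, e] at hr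
    push_cast at hr ⊢
    rw [Nat.factorial_succ]
    push_cast
    linear_combination (-((n'.factorial : ℕ) : ℝ) * ((m'.factorial : ℕ) : ℝ)) * hr +
      a * (m'.factorial : ℕ) * g1 + c * (n'.factorial : ℕ) * g2
  · simp only [hvA, if_false]
    rw [Finset.filter_insert, if_neg hvA, ← hn'] at hn
    rw [Finset.filter_insert, if_pos hvA, Finset.card_insert_of_notMem (by simp [hvT]), ← hm'] at hm
    subst hn hm
    have hr := UU_rec L (b / 2) (a / 2) c (m' + 1) n' (by omega)
    have e : (m' : ℤ) + 1 - 2 = m' - 1 := by ring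
    rw [add_sub_cancel_right, e] at hr
    simp only [UU_symm L (b / 2) (a / 2)] at hr
    push_cast at hr ⊢
    rw [Nat.factorial_succ]
    push_cast
    linear_combination (-((n'.factorial : ℕ) : ℝ) * ((m'.factorial : ℕ) : ℝ)) * hr +
      c * (m'.factorial : ℕ) * g1 + b * (n'.factorial : ℕ) * g2

lemma mdZ0_formula (NA NB : ℕ) (hA hB hAB : ℝ) :
    mdZ0 (NA + NB) NA hA hB hAB = (NA.factorial : ℕ) * (NB.factorial : ℕ) *
      UU (NA + NB + 1) (Real.exp hA / (NA + NB : ℕ) / 2) (Real.exp hB / (NA + NB : ℕ) / 2)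
        (Real.exp hAB / (NA + NB : ℕ)) NA NB := by
  rw [mdZ0_eq]
  have h1 : (Finset.univ.filter fun u : Fin (NA + NB) => (u : ℕ) < NA).card = NA := by
    rw [Fin.card_filter_val_lt]; simp
  apply mdS_eq (NA + NB) NA _ _ _ (NA + NB + 1) (NA + NB) Finset.univ (by simp) (by omega)
  · exact h1
  · have := Finset.card_filter_add_card_filter_not (s := (Finset.univ : Finset (Fin (NA + NB))))
      (fun u => (u : ℕ) < NA)
    rw [h1, Finset.card_univ, Fintype.card_fin] at this
    omega

lemma saddle (a b c α β : ℝ) (ha : 0 < a) (hb : 0 < b) (hc : 0 < c) (hα : 0 < α) (hβ : 0 < β) :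
    ∃ p q : ℝ, 0 < p ∧ 0 < q ∧ p * (1 + a * p + c * q) = α ∧ q * (1 + c * p + b * q) = β := by
  obtain ⟨t0, ht0, ht0e⟩ : ∃ t ∈ Set.Icc 0 α, t + a * t ^ 2 = α := by
    have := intermediate_value_Icc (f := fun t : ℝ => t + a * t ^ 2) hα.le
      (by fun_prop : ContinuousOn _ _)
    have h2 : 0 < a * α ^ 2 := by positivity
    exact this ⟨by simp [hα.le], by linarith⟩
  have ht0p : 0 < t0 := by
    rcases ht0.1.eq_or_lt with h | h
    · rw [← h] at ht0e; norm_num at ht0e; linarith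
    · exact h
  set t1 := α / (1 + a * α + c * β) with ht1
  have hden : 0 < 1 + a * α + c * β := by positivity
  have ht1p : 0 < t1 := by positivity
  have ht1α : t1 ≤ α := by
    rw [ht1]; apply div_le_self hα.le
    have : 0 < a * α := by positivity
    have : 0 < c * β := by positivity
    linarith
  have hdiv : α / t1 = 1 + a * α + c * β := by
    rw [ht1]; field_simp
  have hmul : t1 * (1 + a * α + c * β) = α := by
    rw [ht1]; field_simp
  have ht10 : t1 ≤ t0 := by
    by_contra hlt
    push Not at hlt
    have : t0 + a * t0 ^ 2 < t1 + a * t1 ^ 2 := by gcongr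
    have h2 : a * t1 ^ 2 ≤ t1 * (a * α) := by
      have : a * t1 * t1 ≤ a * t1 * α := by gcongr
      nlinarith
    have : 0 < t1 * (c * β) := by positivity
    nlinarith
  set g : ℝ → ℝ := fun t => (α / t - 1 - a * t) / c with hg
  have hgc : ContinuousOn g (Set.Icc t1 t0) := by
    have : ∀ t ∈ Set.Icc t1 t0, t ≠ 0 := fun t ht => (ht1p.trans_le ht.1).ne'
    exact ContinuousOn.div_const (((continuousOn_const.div continuousOn_id this).sub
      continuousOn_const).sub (by fun_prop)) _
  have hg0 : g t0 = 0 := by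
    have : α / t0 = 1 + a * t0 := by rw [← ht0e]; field_simp
    simp only [hg, this]; ring
  have hg1 : β ≤ g t1 := by
    simp only [hg, hdiv]
    rw [le_div_iff₀ hc]
    have : a * t1 ≤ a * α := by gcongr
    nlinarith
  have hiv := intermediate_value_Icc' (f := fun t => g t * (1 + c * t + b * g t)) ht10
    (hgc.mul ((by fun_prop : ContinuousOn (fun t => 1 + c * t) _).add (continuousOn_const.mul hgc)))
  obtain ⟨t, ht, hte⟩ := hiv (show β ∈ _ by
    constructor
    · simp [hg0, hβ.le]
    · have h1 : 1 ≤ 1 + c * t1 + b * g t1 := by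
        have : 0 < c * t1 := by positivity
        have : 0 < b * g t1 := mul_pos hb (hβ.trans_le hg1)
        linarith
      have h0 : 0 ≤ g t1 := hβ.le.trans hg1
      calc β = β * 1 := by ring
        _ ≤ g t1 * (1 + c * t1 + b * g t1) := by gcongr)
  have htp : 0 < t := ht1p.trans_le ht.1
  refine ⟨t, g t, htp, ?_, ?_, hte⟩
  · have h0 : 0 ≤ g t := by
      apply div_nonneg _ hc.le
      have : t + a * t ^ 2 ≤ t0 + a * t0 ^ 2 := by
        have := ht.2
        gcongr
      have : 1 + a * t ≤ α / t := by
        rw [le_div_iff₀ htp]; nlinarith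
      linarith
    rcases h0.eq_or_lt with h | h
    · simp only [← h] at hte; simp at hte; linarith
    · exact h
  · simp only [hg]
    field_simp
    ring

lemma fact_lim0 : Tendsto (fun n : ℕ => (Real.log (n.factorial : ℕ) - n * Real.log n + n) / n)
    atTop (𝓝 0) := by
  have h1 : Tendsto (fun n : ℕ => Real.log (Stirling.stirlingSeq n)) atTop
      (𝓝 (Real.log (√π))) :=
    (Real.continuousAt_log (by positivity)).tendsto.comp Stirling.tendsto_stirlingSeq_sqrt_pi
  have h2 : Tendsto (fun n : ℕ => Real.log (Stirling.stirlingSeq n) / n) atTop (𝓝 0) :=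
    h1.div_atTop tendsto_natCast_atTop_atTop
  have h3 : Tendsto (fun n : ℕ => Real.log n / (n : ℝ)) atTop (𝓝 0) := by
    have := (Real.isLittleO_log_id_atTop.tendsto_div_nhds_zero).comp
      (tendsto_natCast_atTop_atTop (R := ℝ))
    exact this
  have h4 : Tendsto (fun n : ℕ => Real.log 2 / (n : ℝ)) atTop (𝓝 0) :=
    tendsto_const_nhds.div_atTop tendsto_natCast_atTop_atTop
  have h5 := h2.add ((h3.add h4).const_mul (1 / 2))
  simp only [add_zero, mul_zero] at h5
  refine h5.congr' ?_
  filter_upwards [eventually_gt_atTop 0] with n hn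
  have hn' : (0 : ℝ) < n := by exact_mod_cast hn
  rw [Stirling.log_stirlingSeq_formula, Real.log_mul (by norm_num) hn'.ne',
    Real.log_div hn'.ne' (Real.exp_pos 1).ne', Real.log_exp]
  field_simp
  ring

lemma fact_lim {l : Filter ℕ} (hl : l ≤ atTop) (k : ℕ → ℕ) (κ : ℝ) (hκ : 0 < κ)
    (hk : Tendsto (fun N => (k N : ℝ) / N) l (𝓝 κ)) :
    Tendsto (fun N : ℕ => (N : ℝ)⁻¹ * (Real.log ((k N).factorial : ℕ) - k N * Real.log N)) l
      (𝓝 (κ * Real.log κ - κ)) := by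
  have hN : Tendsto (fun N : ℕ => (N : ℝ)) l atTop := tendsto_natCast_atTop_atTop.mono_left hl
  have hkt : Tendsto (fun N => k N) l atTop := by
    rw [← tendsto_natCast_atTop_iff (R := ℝ)]
    have := hk.pos_mul_atTop hκ hN
    refine this.congr' ?_
    filter_upwards [hN.eventually_gt_atTop 0] with N h
    field_simp
  have h1 := (fact_lim0.comp hkt).mul hk
  have h2 := hk.mul ((Real.continuousAt_log hκ.ne').tendsto.comp hk)
  have h3 := (h1.add h2).sub hk
  simp only [zero_mul, zero_add] at h3
  refine h3.congr' ?_
  filter_upwards [hN.eventually_gt_atTop 0, hkt.eventually_gt_atTop 0] with N h h'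
  have h'' : (0 : ℝ) < k N := by exact_mod_cast h'
  simp only [Function.comp]
  rw [Real.log_div h''.ne' h.ne']
  field_simp
  ring

def PhiStar (hA hB hAB α p q : ℝ) : ℝ :=
  α * Real.log (1 + Real.exp hA * p + Real.exp hAB * q) +
    (1 - α) * Real.log (1 + Real.exp hAB * p + Real.exp hB * q) -
    (Real.exp hA * p ^ 2 + 2 * Real.exp hAB * (p * q) + Real.exp hB * q ^ 2) / 2

lemma log_trm {hA hB hAB : ℝ} {N n m i j k P Q : ℕ} (hN : 0 < N) (hn : n = 2 * i + k + P)
    (hm : m = 2 * j + k + Q) :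
    0 < trm (Real.exp hA / N / 2) (Real.exp hB / N / 2) (Real.exp hAB / N) n m i j k ∧
    Real.log (trm (Real.exp hA / N / 2) (Real.exp hB / N / 2) (Real.exp hAB / N) n m i j k) =
      i * (hA - Real.log N - Real.log 2) - Real.log (i.factorial : ℕ) +
      (j * (hB - Real.log N - Real.log 2) - Real.log (j.factorial : ℕ)) +
      (k * (hAB - Real.log N) - Real.log (k.factorial : ℕ)) - Real.log (P.factorial : ℕ) -
      Real.log (Q.factorial : ℕ) := by
  have a1 : (n : ℤ) - 2 * i - k = (P : ℕ) := by subst hn; push_cast; ring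
  have a2 : (m : ℤ) - 2 * j - k = (Q : ℕ) := by subst hm; push_cast; ring
  have hN' : (0 : ℝ) < N := by exact_mod_cast hN
  unfold trm
  rw [a1, a2, rfac_nat, rfac_nat]
  refine ⟨by positivity, ?_⟩
  rw [Real.log_mul (by positivity) (by positivity), Real.log_mul (by positivity) (by positivity),
    Real.log_mul (by positivity) (by positivity), Real.log_mul (by positivity) (by positivity),
    Real.log_div (by positivity) (by positivity), Real.log_div (by positivity) (by positivity),
    Real.log_div (by positivity) (by positivity), Real.log_pow, Real.log_pow, Real.log_pow,
    Real.log_div (by positivity) (by positivity), Real.log_div (by positivity) (by positivity),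
    Real.log_div (by positivity) (by positivity), Real.log_div (by positivity) (by positivity),
    Real.log_div (by positivity) (by positivity), Real.log_exp, Real.log_exp, Real.log_exp,
    Real.log_inv, Real.log_inv]
  ring

lemma floor_lim {l : Filter ℕ} (hl : l ≤ atTop) (x : ℝ) (hx : 0 ≤ x) :
    Tendsto (fun N : ℕ => (⌊x * N⌋₊ : ℝ) / N) l (𝓝 x) :=
  ((tendsto_nat_floor_mul_div_atTop hx).comp tendsto_natCast_atTop_atTop).mono_left hl

lemma lim_Z (hA hB hAB α p q : ℝ) (hα : α ∈ Set.Ioo (0 : ℝ) 1) (hp : 0 < p) (hq : 0 < q)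
    (e1 : p * (1 + Real.exp hA * p + Real.exp hAB * q) = α)
    (e2 : q * (1 + Real.exp hAB * p + Real.exp hB * q) = 1 - α) :
    Tendsto (fun N : ℕ => (N : ℝ)⁻¹ * Real.log (mdZ0 N ⌊α * N⌋₊ hA hB hAB))
      (atTop ⊓ 𝓟 {N : ℕ | ∃ m : ℕ, (m : ℝ) = α * N}) (𝓝 (PhiStar hA hB hAB α p q)) := by
  set l := atTop ⊓ 𝓟 {N : ℕ | ∃ m : ℕ, (m : ℝ) = α * N} with hl'
  have hl : l ≤ atTop := inf_le_left
  have hlN : ∀ᶠ N in l, 0 < N := hl (eventually_gt_atTop 0)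
  have hG : ∀ᶠ N : ℕ in l, ((⌊α * N⌋₊ : ℕ) : ℝ) = α * N := by
    have : ∀ᶠ N : ℕ in l, N ∈ {N : ℕ | ∃ m : ℕ, (m : ℝ) = α * N} :=
      (inf_le_right : l ≤ _) (mem_principal_self _)
    filter_upwards [this] with N hN
    obtain ⟨m, hm⟩ := hN
    rw [← hm, Nat.floor_natCast]
  obtain ⟨hα0, hα1⟩ := hα
  have hβ0 : 0 < 1 - α := by linarith
  set nA : ℕ → ℕ := fun N => ⌊α * N⌋₊ with hnA
  set nB : ℕ → ℕ := fun N => N - ⌊α * N⌋₊ with hnB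
  have hle : ∀ N, nA N ≤ N := by
    intro N
    apply Nat.floor_le_of_le
    have : (0 : ℝ) ≤ N := by positivity
    nlinarith
  have hAB' : ∀ N, nA N + nB N = N := fun N => Nat.add_sub_cancel' (hle N)
  have hABr : ∀ N, (nA N : ℝ) + nB N = N := fun N => by exact_mod_cast hAB' N
  have hNne : ∀ᶠ N : ℕ in l, (N : ℝ) ≠ 0 := by
    filter_upwards [hlN] with N h
    positivity
  have lA : Tendsto (fun N => (nA N : ℝ) / N) l (𝓝 α) := floor_lim hl α hα0.le
  have lB : Tendsto (fun N => (nB N : ℝ) / N) l (𝓝 (1 - α)) := by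
    refine (lA.const_sub 1).congr' ?_
    filter_upwards [hNne] with N h
    have := hABr N
    field_simp
    linarith
  have fA := fact_lim hl nA α hα0 lA
  have fB := fact_lim hl nB (1 - α) hβ0 lB
  have hform : ∀ N, mdZ0 N ⌊α * N⌋₊ hA hB hAB = ((nA N).factorial : ℕ) * ((nB N).factorial : ℕ) *
      UU (N + 1) (Real.exp hA / N / 2) (Real.exp hB / N / 2) (Real.exp hAB / N)
        (nA N) (nB N) := by
    intro N
    have := mdZ0_formula (nA N) (nB N) hA hB hAB
    rw [hAB' N] at this
    exact this
  have hl1 : Real.log (1 + Real.exp hA * p + Real.exp hAB * q) = Real.log α - Real.log p := by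
    rw [← e1, Real.log_mul hp.ne' (by positivity)]; ring
  have hl2 : Real.log (1 + Real.exp hAB * p + Real.exp hB * q) = Real.log (1 - α) - Real.log q := by
    rw [← e2, Real.log_mul hq.ne' (by positivity)]; ring
  set I := Real.exp hA / 2 * p ^ 2 with hI
  set J := Real.exp hB / 2 * q ^ 2 with hJ
  set K := Real.exp hAB * (p * q) with hK
  have hI0 : 0 < I := by positivity
  have hJ0 : 0 < J := by positivity
  have hK0 : 0 < K := by positivity
  have e1' : α = 2 * I + K + p := by rw [← e1, hI, hK]; ring
  have e2' : 1 - α = 2 * J + K + q := by rw [← e2, hJ, hK]; ring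
  have hPhi : PhiStar hA hB hAB α p q = α * (Real.log α - Real.log p) +
      (1 - α) * (Real.log (1 - α) - Real.log q) - (I + K + J) := by
    unfold PhiStar
    rw [hl1, hl2, hI, hJ, hK]; ring
  -- lower function
  set i : ℕ → ℕ := fun N => ⌊I * N⌋₊ with hi
  set j : ℕ → ℕ := fun N => ⌊J * N⌋₊ with hj
  set k : ℕ → ℕ := fun N => ⌊K * N⌋₊ with hk
  have li : Tendsto (fun N => (i N : ℝ) / N) l (𝓝 I) := floor_lim hl I hI0.le
  have lj : Tendsto (fun N => (j N : ℝ) / N) l (𝓝 J) := floor_lim hl J hJ0.le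
  have lk : Tendsto (fun N => (k N : ℝ) / N) l (𝓝 K) := floor_lim hl K hK0.le
  set P : ℕ → ℕ := fun N => nA N - (2 * i N + k N) with hP
  set Q : ℕ → ℕ := fun N => nB N - (2 * j N + k N) with hQ
  have hil : ∀ N, (i N : ℝ) ≤ I * N := fun N => Nat.floor_le (by positivity)
  have hjl : ∀ N, (j N : ℝ) ≤ J * N := fun N => Nat.floor_le (by positivity)
  have hkl : ∀ N, (k N : ℝ) ≤ K * N := fun N => Nat.floor_le (by positivity)
  have hPe : ∀ᶠ N in l, nA N = 2 * i N + k N + P N := by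
    filter_upwards [hG] with N hN
    have h1 : ((2 * i N + k N : ℕ) : ℝ) ≤ nA N := by
      have h3 : (nA N : ℝ) = α * N := hN
      have : (0 : ℝ) ≤ p * N := by positivity
      rw [h3, e1']
      push_cast
      linarith [hil N, hkl N]
    have h2 : 2 * i N + k N ≤ nA N := by exact_mod_cast h1
    simp only [hP]; omega
  have hQe : ∀ᶠ N in l, nB N = 2 * j N + k N + Q N := by
    filter_upwards [hG] with N hN
    have h1 : ((2 * j N + k N : ℕ) : ℝ) ≤ nB N := by
      have h3 : (nA N : ℝ) = α * N := hN
      have h4 : (nB N : ℝ) = (1 - α) * N := by linarith [hABr N]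
      have : (0 : ℝ) ≤ q * N := by positivity
      rw [h4, e2']
      push_cast
      linarith [hjl N, hkl N]
    have h2 : 2 * j N + k N ≤ nB N := by exact_mod_cast h1
    simp only [hQ]; omega
  have lP : Tendsto (fun N => (P N : ℝ) / N) l (𝓝 p) := by
    have := (lA.sub (li.const_mul 2)).sub lk
    rw [show α - 2 * I - K = p by rw [e1']; ring] at this
    refine this.congr' ?_
    filter_upwards [hPe, hNne] with N h h0
    have : (nA N : ℝ) = 2 * i N + k N + P N := by exact_mod_cast h
    rw [this]
    field_simp
    ring
  have lQ : Tendsto (fun N => (Q N : ℝ) / N) l (𝓝 q) := by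
    have := (lB.sub (lj.const_mul 2)).sub lk
    rw [show 1 - α - 2 * J - K = q by rw [e2']; ring] at this
    refine this.congr' ?_
    filter_upwards [hQe, hNne] with N h h0
    have : (nB N : ℝ) = 2 * j N + k N + Q N := by exact_mod_cast h
    rw [this]
    field_simp
    ring
  have fi := fact_lim hl i I hI0 li
  have fj := fact_lim hl j J hJ0 lj
  have fk := fact_lim hl k K hK0 lk
  have fP := fact_lim hl P p hp lP
  have fQ := fact_lim hl Q q hq lQ
  have hlow := ((((((((fA.add fB).add (li.mul_const (hA - Real.log 2))).add
    (lj.mul_const (hB - Real.log 2))).add (lk.mul_const hAB)).sub fi).sub fj).sub fk).sub fP).sub fQ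
  have hlogN : Tendsto (fun N : ℕ => 3 * (Real.log (N + 1 : ℕ) / N)) l (𝓝 0) := by
    have h3 : Tendsto (fun n : ℕ => Real.log (n + 1 : ℕ) / ((n + 1 : ℕ) : ℝ)) atTop (𝓝 0) := by
      have := (Real.isLittleO_log_id_atTop.tendsto_div_nhds_zero).comp
        ((tendsto_natCast_atTop_atTop (R := ℝ)).comp (tendsto_add_atTop_nat 1))
      exact this
    have h4 : Tendsto (fun n : ℕ => 1 + 1 / (n : ℝ)) atTop (𝓝 (1 + 0)) :=
      tendsto_const_nhds.add tendsto_one_div_atTop_nhds_zero_nat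
    have h5 := ((h3.mul h4).const_mul 3).mono_left hl
    rw [zero_mul, mul_zero] at h5
    refine h5.congr' ?_
    filter_upwards [hNne] with N h
    have : ((N + 1 : ℕ) : ℝ) ≠ 0 := by positivity
    field_simp
    push_cast
    ring
  have hup := ((((fA.add fB).add hlogN).add_const (p + q + I + J + K)).sub
    (lA.mul_const (Real.log p))).sub (lB.mul_const (Real.log q))
  have hlogI : Real.log I = hA - Real.log 2 + 2 * Real.log p := by
    rw [hI, Real.log_mul (by positivity) (by positivity), Real.log_div (by positivity) (by positivity),
      Real.log_exp, Real.log_pow]; push_cast; ring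
  have hlogJ : Real.log J = hB - Real.log 2 + 2 * Real.log q := by
    rw [hJ, Real.log_mul (by positivity) (by positivity), Real.log_div (by positivity) (by positivity),
      Real.log_exp, Real.log_pow]; push_cast; ring
  have hlogK : Real.log K = hAB + Real.log p + Real.log q := by
    rw [hK, Real.log_mul (by positivity) (by positivity), Real.log_mul (by positivity) (by positivity),
      Real.log_exp]; ring
  refine tendsto_of_tendsto_of_tendsto_of_le_of_le' (hlow.trans (le_of_eq ?_))
    (hup.trans (le_of_eq ?_)) ?_ ?_
  · congr 1
    rw [hPhi, hlogI, hlogJ, hlogK]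
    linear_combination (Real.log p - 1) * e1' + (Real.log q - 1) * e2'
  · congr 1
    rw [hPhi]
    linear_combination (-1 : ℝ) * e1' - e2'
  · filter_upwards [hlN, hNne, hPe, hQe, hG] with N hN0 hN hP hQ hGN
    obtain ⟨t0, t1⟩ := log_trm (hA := hA) (hB := hB) (hAB := hAB) hN0 hP hQ
    have hNr : (0 : ℝ) < N := by exact_mod_cast hN0
    have hle := le_UU (A := Real.exp hA / N / 2) (B := Real.exp hB / N / 2) (C := Real.exp hAB / N)
      (by positivity) (by positivity) (by positivity) (N + 1) (nA N) (nB N) (i N) (j N) (k N)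
      (by have := hAB' N; omega) (by have := hAB' N; omega) (by have := hAB' N; omega)
    have h1 : Real.log (((nA N).factorial : ℕ) * ((nB N).factorial : ℕ) *
        trm (Real.exp hA / N / 2) (Real.exp hB / N / 2) (Real.exp hAB / N) (nA N) (nB N)
          (i N) (j N) (k N)) ≤ Real.log (mdZ0 N ⌊α * N⌋₊ hA hB hAB) := by
      rw [hform]
      apply Real.log_le_log (by positivity)
      gcongr
    rw [Real.log_mul (by positivity) t0.ne', Real.log_mul (by positivity) (by positivity), t1] at h1
    refine le_trans (le_of_eq ?_) (mul_le_mul_of_nonneg_left h1 (by positivity))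
    have hPr : (nA N : ℝ) = 2 * i N + k N + P N := by exact_mod_cast hP
    have hQr : (nB N : ℝ) = 2 * j N + k N + Q N := by exact_mod_cast hQ
    rw [hPr, hQr]
    field_simp
    ring
  · filter_upwards [hlN, hNne, hPe, hQe] with N hN0 hN hP hQ
    have hNr : (0 : ℝ) < N := by exact_mod_cast hN0
    obtain ⟨t0, t1⟩ := log_trm (hA := hA) (hB := hB) (hAB := hAB) hN0 hP hQ
    have hle := le_UU (A := Real.exp hA / N / 2) (B := Real.exp hB / N / 2) (C := Real.exp hAB / N)
      (by positivity) (by positivity) (by positivity) (N + 1) (nA N) (nB N) (i N) (j N) (k N)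
      (by have := hAB' N; omega) (by have := hAB' N; omega) (by have := hAB' N; omega)
    have hU : 0 < UU (N + 1) (Real.exp hA / N / 2) (Real.exp hB / N / 2) (Real.exp hAB / N)
        (nA N) (nB N) := t0.trans_le hle
    have h2 := UU_le (A := Real.exp hA / N / 2) (B := Real.exp hB / N / 2) (C := Real.exp hAB / N)
      (r := N * p) (s := N * q)
      (by positivity) (by positivity) (by positivity) (by positivity) (by positivity)
      (N + 1) (nA N) (nB N)
    have h3 := Real.log_le_log (by positivity) h2
    rw [Real.log_mul hU.ne' (by positivity), Real.log_mul (by positivity) (by positivity),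
      Real.log_mul (by positivity) (by positivity), Real.log_pow, Real.log_pow, Real.log_pow,
      Real.log_exp, Real.log_mul hN hp.ne', Real.log_mul hN hq.ne'] at h3
    rw [hform, Real.log_mul (by positivity) hU.ne', Real.log_mul (by positivity) (by positivity)]
    have h4 : N * p + N * q + Real.exp hA / N / 2 * (N * p) ^ 2 + Real.exp hB / N / 2 * (N * q) ^ 2 +
      Real.exp hAB / N * (N * p * (N * q)) = N * (p + q + I + J + K) := by
      rw [hI, hJ, hK]; field_simp
    rw [h4] at h3
    rw [inv_mul_le_iff₀ hNr]
    refine le_trans (add_le_add_right (le_sub_iff_add_le.mpr h3) _) (le_of_eq ?_)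
    push_cast
    field_simp
    ring

def quadW (hA hB hAB : ℝ) (x : Fin 2 → ℝ) : ℝ :=
  (Real.exp hB * x 0 ^ 2 - 2 * Real.exp hAB * (x 0 * x 1) + Real.exp hA * x 1 ^ 2) /
    (Real.exp hA * Real.exp hB - Real.exp hAB ^ 2)

lemma det_covW (hA hB hAB : ℝ) :
    (covW hA hB hAB).det = Real.exp hA * Real.exp hB - Real.exp hAB ^ 2 := by
  simp [covW, Matrix.det_fin_two_of]; ring

lemma gauss_eq (hA hB hAB : ℝ) (hd : 0 < Real.exp hA * Real.exp hB - Real.exp hAB ^ 2) (N : ℕ)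
    (hN : 0 < N) (x : Fin 2 → ℝ) :
    gaussDensity ((N : ℝ)⁻¹ • covW hA hB hAB) x =
      N / (2 * π * √(Real.exp hA * Real.exp hB - Real.exp hAB ^ 2)) *
        Real.exp (-(N * (quadW hA hB hAB x / 2))) := by
  have hN' : (0 : ℝ) < N := by exact_mod_cast hN
  have hdet : ((N : ℝ)⁻¹ • covW hA hB hAB).det =
      (Real.exp hA * Real.exp hB - Real.exp hAB ^ 2) / (N : ℝ) ^ 2 := by
    rw [Matrix.det_smul, det_covW]
    simp
    field_simp
  have hinv : ((N : ℝ)⁻¹ • covW hA hB hAB)⁻¹ =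
      ((N : ℝ) / (Real.exp hA * Real.exp hB - Real.exp hAB ^ 2)) •
        !![Real.exp hB, -Real.exp hAB; -Real.exp hAB, Real.exp hA] := by
    rw [Matrix.inv_def, hdet, Ring.inverse_eq_inv']
    ext i j
    fin_cases i <;> fin_cases j <;> simp [covW, Matrix.adjugate_fin_two] <;> field_simp
  unfold gaussDensity
  rw [hinv, hdet, Real.sqrt_div hd.le, Real.sqrt_sq hN'.le]
  congr 1
  · have := Real.sqrt_pos.mpr hd
    field_simp
  · congr 1
    unfold quadW
    simp [dotProduct, Matrix.mulVec, Fin.sum_univ_two]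
    field_simp
    ring

open ProbabilityTheory in
lemma gauss_split (hA hB hAB : ℝ) (hd : 0 < Real.exp hA * Real.exp hB - Real.exp hAB ^ 2) (N : ℕ)
    (hN : 0 < N) (x : Fin 2 → ℝ) :
    N / (2 * π * √(Real.exp hA * Real.exp hB - Real.exp hAB ^ 2)) *
        Real.exp (-(N * (quadW hA hB hAB x / 2))) =
    gaussianPDFReal 0 (Real.exp hA / N).toNNReal (x 0) *
      gaussianPDFReal (Real.exp hAB / Real.exp hA * x 0)
        ((Real.exp hA * Real.exp hB - Real.exp hAB ^ 2) / (N * Real.exp hA)).toNNReal (x 1) := by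
  have hN' : (0 : ℝ) < N := by exact_mod_cast hN
  set d := Real.exp hA * Real.exp hB - Real.exp hAB ^ 2 with hdd
  have ha := Real.exp_pos hA
  unfold gaussianPDFReal
  rw [Real.coe_toNNReal _ (by positivity), Real.coe_toNNReal _ (by positivity)]
  rw [mul_mul_mul_comm, ← Real.exp_add]
  congr 1
  · rw [← mul_inv, ← Real.sqrt_mul (by positivity)]
    rw [show 2 * π * (Real.exp hA / N) * (2 * π * (d / (N * Real.exp hA))) =
      (2 * π / N) ^ 2 * d by field_simp]
    rw [Real.sqrt_mul (by positivity), Real.sqrt_sq (by positivity)]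
    have := Real.sqrt_pos.mpr hd
    field_simp
  · congr 1
    unfold quadW
    rw [← hdd]
    field_simp
    rw [hdd]
    ring

open ProbabilityTheory in
lemma lint_gauss (v v' : NNReal) (hv : v ≠ 0) (hv' : v' ≠ 0) (κ : ℝ) :
    ∫⁻ x : Fin 2 → ℝ, ENNReal.ofReal (gaussianPDFReal 0 v (x 0) *
      gaussianPDFReal (κ * x 0) v' (x 1)) = 1 := by
  have hmeas : Measurable (fun z : ℝ × ℝ => ENNReal.ofReal (gaussianPDFReal 0 v z.1 *
      gaussianPDFReal (κ * z.1) v' z.2)) := by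
    unfold gaussianPDFReal
    fun_prop
  have h := (volume_preserving_finTwoArrow ℝ).lintegral_comp hmeas
  simp only [MeasurableEquiv.finTwoArrow_apply] at h
  rw [h, Measure.volume_eq_prod, lintegral_prod _ hmeas.aemeasurable]
  have : ∀ x : ℝ, ∫⁻ y : ℝ, ENNReal.ofReal (gaussianPDFReal 0 v x *
      gaussianPDFReal (κ * x) v' y) = ENNReal.ofReal (gaussianPDFReal 0 v x) := by
    intro x
    simp_rw [ENNReal.ofReal_mul (gaussianPDFReal_nonneg 0 v x)]
    rw [lintegral_const_mul _ (by fun_prop), lintegral_gaussianPDFReal_eq_one _ hv', mul_one]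
  simp_rw [this]
  exact lintegral_gaussianPDFReal_eq_one _ hv

lemma gauss_int (hA hB hAB : ℝ) (hd : 0 < Real.exp hA * Real.exp hB - Real.exp hAB ^ 2) (N : ℕ)
    (hN : 0 < N) :
    Integrable (fun x : Fin 2 → ℝ =>
      N / (2 * π * √(Real.exp hA * Real.exp hB - Real.exp hAB ^ 2)) *
        Real.exp (-(N * (quadW hA hB hAB x / 2)))) ∧
    ∫ x : Fin 2 → ℝ,
      N / (2 * π * √(Real.exp hA * Real.exp hB - Real.exp hAB ^ 2)) *
        Real.exp (-(N * (quadW hA hB hAB x / 2))) = 1 := by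
  have hN' : (0 : ℝ) < N := by exact_mod_cast hN
  have ha := Real.exp_pos hA
  have h1 := lint_gauss (Real.exp hA / N).toNNReal
    ((Real.exp hA * Real.exp hB - Real.exp hAB ^ 2) / (N * Real.exp hA)).toNNReal
    (by rw [Ne, Real.toNNReal_eq_zero, not_le]; positivity)
    (by rw [Ne, Real.toNNReal_eq_zero, not_le]; positivity) (Real.exp hAB / Real.exp hA)
  simp_rw [← gauss_split hA hB hAB hd N hN] at h1
  have hm : AEStronglyMeasurable (fun x : Fin 2 → ℝ =>
      N / (2 * π * √(Real.exp hA * Real.exp hB - Real.exp hAB ^ 2)) *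
        Real.exp (-(N * (quadW hA hB hAB x / 2)))) := by
    unfold quadW
    fun_prop
  have hnn : 0 ≤ᵐ[volume] (fun x : Fin 2 → ℝ =>
      N / (2 * π * √(Real.exp hA * Real.exp hB - Real.exp hAB ^ 2)) *
        Real.exp (-(N * (quadW hA hB hAB x / 2)))) :=
    Eventually.of_forall fun x => by simp only [Pi.zero_apply]; positivity
  constructor
  · refine ⟨hm, ?_⟩
    rw [hasFiniteIntegral_iff_ofReal hnn, h1]
    simp
  · rw [integral_eq_lintegral_of_nonneg_ae hnn hm, h1]
    simp

def PhiX (hA hB hAB α : ℝ) (x : Fin 2 → ℝ) : ℝ :=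
  α * Real.log (1 + x 0) + (1 - α) * Real.log (1 + x 1) - quadW hA hB hAB x / 2

lemma Zstar_eq (hA hB hAB : ℝ) (hd : 0 < Real.exp hA * Real.exp hB - Real.exp hAB ^ 2) (N : ℕ)
    (hN : 0 < N) (α : ℝ) (hα : α ∈ Set.Ioo (0 : ℝ) 1) (hm : ∃ m : ℕ, (m : ℝ) = α * N) :
    Zstar ⌊α * N⌋₊ (N - ⌊α * N⌋₊) hA hB hAB = ∫ x : Fin 2 → ℝ in {x | -1 < x 0 ∧ -1 < x 1},
      N / (2 * π * √(Real.exp hA * Real.exp hB - Real.exp hAB ^ 2)) *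
        Real.exp (N * PhiX hA hB hAB α x) := by
  obtain ⟨m, hm⟩ := hm
  have hN' : (0 : ℝ) < N := by exact_mod_cast hN
  rw [← hm, Nat.floor_natCast]
  have hmN : m ≤ N := by
    have : (m : ℝ) ≤ N := by rw [hm]; nlinarith [hα.2]
    exact_mod_cast this
  unfold Zstar
  rw [Nat.add_sub_cancel' hmN]
  apply setIntegral_congr_fun
  · exact (measurableSet_lt measurable_const (measurable_pi_apply 0)).inter
      (measurableSet_lt measurable_const (measurable_pi_apply 1))
  intro x hx
  have h0 : 0 < 1 + x 0 := by linarith [hx.1]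
  have h1 : 0 < 1 + x 1 := by linarith [hx.2]
  simp only
  rw [gauss_eq hA hB hAB hd N hN, ← Real.exp_log (pow_pos h0 m),
    ← Real.exp_log (pow_pos h1 (N - m)), Real.log_pow, Real.log_pow, Nat.cast_sub hmN, hm,
    mul_left_comm]
  congr 1
  rw [← Real.exp_add, ← Real.exp_add]
  congr 1
  unfold PhiX
  ring

lemma PhiX_le (hA hB hAB : ℝ) (hd : 0 < Real.exp hA * Real.exp hB - Real.exp hAB ^ 2)
    (α p q : ℝ) (hα : α ∈ Set.Ioo (0 : ℝ) 1) (hp : 0 < p) (hq : 0 < q)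
    (e1 : p * (1 + Real.exp hA * p + Real.exp hAB * q) = α)
    (e2 : q * (1 + Real.exp hAB * p + Real.exp hB * q) = 1 - α)
    (x : Fin 2 → ℝ) (h0 : -1 < x 0) (h1 : -1 < x 1) :
    PhiX hA hB hAB α x ≤ PhiStar hA hB hAB α p q - quadW hA hB hAB
      (x - ![Real.exp hA * p + Real.exp hAB * q, Real.exp hAB * p + Real.exp hB * q]) / 2 := by
  have ha := Real.exp_pos hA
  have hb := Real.exp_pos hB
  have hc := Real.exp_pos hAB
  set a := Real.exp hA
  set b := Real.exp hB
  set c := Real.exp hAB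
  have key : ∀ (y z w t : ℝ), 0 < y → 0 < z → 0 < t → w * z = t →
      t * Real.log y ≤ t * Real.log z + w * (y - z) := by
    intro y z w t hy hz ht hw
    have := Real.log_le_sub_one_of_pos (div_pos hy hz)
    rw [Real.log_div hy.ne' hz.ne'] at this
    have h2 := mul_le_mul_of_nonneg_left this ht.le
    have h3 : t * (y / z - 1) = w * (y - z) := by rw [← hw]; field_simp
    linarith
  have k1 := key (1 + x 0) (1 + a * p + c * q) p α (by linarith) (by positivity) hα.1 e1
  have k2 := key (1 + x 1) (1 + c * p + b * q) q (1 - α) (by linarith) (by positivity)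
    (by linarith [hα.2]) e2
  have k3 : quadW hA hB hAB x = quadW hA hB hAB (x - ![a * p + c * q, c * p + b * q]) +
      2 * (p * (x 0 - (a * p + c * q)) + q * (x 1 - (c * p + b * q))) +
      (a * p ^ 2 + 2 * c * (p * q) + b * q ^ 2) := by
    unfold quadW
    change _ / (a * b - c ^ 2) = _ / (a * b - c ^ 2) + _ + _
    simp only [Pi.sub_apply, Matrix.cons_val_zero, Matrix.cons_val_one]
    field_simp
    ring
  unfold PhiX PhiStar
  rw [k3]
  change _ ≤ α * Real.log (1 + a * p + c * q) + (1 - α) * Real.log (1 + c * p + b * q) -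
    (a * p ^ 2 + 2 * c * (p * q) + b * q ^ 2) / 2 - _
  linarith

lemma PhiX_star (hA hB hAB : ℝ) (hd : 0 < Real.exp hA * Real.exp hB - Real.exp hAB ^ 2)
    (α p q : ℝ) :
    PhiX hA hB hAB α
      ![Real.exp hA * p + Real.exp hAB * q, Real.exp hAB * p + Real.exp hB * q] =
      PhiStar hA hB hAB α p q := by
  unfold PhiX PhiStar quadW
  simp only [Matrix.cons_val_zero, Matrix.cons_val_one, ← add_assoc]
  field_simp
  ring

theorem stmt17 (hA hB hAB : ℝ) (hW : (covW hA hB hAB).PosDef)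
    (α : ℝ) (hα : α ∈ Set.Ioo (0 : ℝ) 1) (hαQ : ∃ q : ℚ, (q : ℝ) = α) :
    Tendsto (fun N : ℕ => (N : ℝ)⁻¹ * Real.log (mdZ0 N ⌊α * N⌋₊ hA hB hAB))
      (atTop ⊓ 𝓟 {N : ℕ | ∃ m : ℕ, (m : ℝ) = α * N})
      (𝓝 (sSup {y : ℝ | ∃ N : ℕ, 0 < N ∧ (∃ m : ℕ, (m : ℝ) = α * N) ∧
        y = (N : ℝ)⁻¹ * Real.log (Zstar ⌊α * N⌋₊ (N - ⌊α * N⌋₊) hA hB hAB)})) := by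
  have hd : 0 < Real.exp hA * Real.exp hB - Real.exp hAB ^ 2 := by
    rw [← det_covW]; exact hW.det_pos
  obtain ⟨p, q, hp, hq, e1, e2⟩ := saddle (Real.exp hA) (Real.exp hB) (Real.exp hAB) α (1 - α)
    (Real.exp_pos _) (Real.exp_pos _) (Real.exp_pos _) hα.1 (by linarith [hα.2])
  have hlim := lim_Z hA hB hAB α p q hα hp hq e1 e2
  convert hlim using 2
  set Φ := PhiStar hA hB hAB α p q with hΦ
  set xs : Fin 2 → ℝ := ![Real.exp hA * p + Real.exp hAB * q, Real.exp hAB * p + Real.exp hB * q]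
    with hxs
  have hxs0 : 0 < xs 0 := by simp only [hxs, Matrix.cons_val_zero]; positivity
  have hxs1 : 0 < xs 1 := by 
    have : xs 1 = Real.exp hAB * p + Real.exp hB * q := by simp [hxs]
    rw [this]; positivity
  set QQ : Set (Fin 2 → ℝ) := {x | -1 < x 0 ∧ -1 < x 1} with hQQ
  have hQm : MeasurableSet QQ := (measurableSet_lt measurable_const (measurable_pi_apply 0)).inter
      (measurableSet_lt measurable_const (measurable_pi_apply 1))
  have hQo : IsOpen QQ := (isOpen_lt continuous_const (continuous_apply 0)).inter
      (isOpen_lt continuous_const (continuous_apply 1))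
  set D := 2 * π * √(Real.exp hA * Real.exp hB - Real.exp hAB ^ 2) with hD
  have hD0 : 0 < D := by exact mul_pos (by positivity) (Real.sqrt_pos.mpr hd)
  -- domination
  have hdom : ∀ N : ℕ, 0 < N → ∀ x ∈ QQ, N / D * Real.exp (N * PhiX hA hB hAB α x) ≤
      Real.exp (N * Φ) * (N / D * Real.exp (-(N * (quadW hA hB hAB (x - xs) / 2)))) := by
    intro N hN x hx
    have h := PhiX_le hA hB hAB hd α p q hα hp hq e1 e2 x hx.1 hx.2
    rw [mul_left_comm, ← Real.exp_add]
    gcongr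
    have : (0 : ℝ) ≤ N := by positivity
    nlinarith
  have hgi : ∀ N : ℕ, 0 < N → Integrable (fun x : Fin 2 → ℝ =>
      Real.exp (N * Φ) * (N / D * Real.exp (-(N * (quadW hA hB hAB (x - xs) / 2))))) := by
    intro N hN
    exact ((gauss_int hA hB hAB hd N hN).1.comp_sub_right xs).const_mul _
  have hFi : ∀ N : ℕ, 0 < N → IntegrableOn (fun x : Fin 2 → ℝ =>
      N / D * Real.exp (N * PhiX hA hB hAB α x)) QQ := by
    intro N hN
    refine Integrable.mono' (hgi N hN).integrableOn ?_ ?_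
    · apply Measurable.aestronglyMeasurable
      unfold PhiX quadW
      fun_prop
    · filter_upwards [ae_restrict_mem hQm] with x hx
      rw [Real.norm_of_nonneg (by positivity)]
      exact hdom N hN x hx
  have hupper : ∀ N : ℕ, 0 < N → ∫ x in QQ, N / D * Real.exp (N * PhiX hA hB hAB α x) ≤
      Real.exp (N * Φ) := by
    intro N hN
    calc _ ≤ ∫ x in QQ, Real.exp (N * Φ) *
          (N / D * Real.exp (-(N * (quadW hA hB hAB (x - xs) / 2)))) :=
          setIntegral_mono_on (hFi N hN) (hgi N hN).integrableOn hQm (hdom N hN)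
      _ ≤ ∫ x, Real.exp (N * Φ) *
          (N / D * Real.exp (-(N * (quadW hA hB hAB (x - xs) / 2)))) :=
          setIntegral_le_integral (hgi N hN)
            (Eventually.of_forall fun x => by simp only [Pi.zero_apply]; positivity)
      _ = Real.exp (N * Φ) := by
          rw [integral_const_mul]
          rw [integral_sub_right_eq_self (fun x : Fin 2 → ℝ =>
            N / D * Real.exp (-(N * (quadW hA hB hAB x / 2)))) xs]
          rw [(gauss_int hA hB hAB hd N hN).2, mul_one]
  have hlower : ∀ ε : ℝ, 0 < ε → ∃ v : ℝ, 0 < v ∧ ∀ N : ℕ, 0 < N →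
      N * v * Real.exp (N * (Φ - ε)) ≤
        ∫ x in QQ, N / D * Real.exp (N * PhiX hA hB hAB α x) := by
    intro ε hε
    have hcont : ContinuousAt (PhiX hA hB hAB α) xs := by
      unfold PhiX quadW
      have c0 : ContinuousAt (fun x : Fin 2 → ℝ => Real.log (1 + x 0)) xs :=
        ContinuousAt.log (continuous_const.add (continuous_apply 0)).continuousAt (by linarith)
      have c1 : ContinuousAt (fun x : Fin 2 → ℝ => Real.log (1 + x 1)) xs :=
        ContinuousAt.log (continuous_const.add (continuous_apply 1)).continuousAt (by linarith)
      fun_prop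
    have hev : ∀ᶠ x in 𝓝 xs, Φ - ε < PhiX hA hB hAB α x ∧ x ∈ QQ := by
      refine (hcont.eventually_const_lt ?_).and (hQo.mem_nhds ⟨by linarith, by linarith⟩)
      rw [hxs, PhiX_star hA hB hAB hd]
      linarith
    obtain ⟨r, hr, hball⟩ := Metric.eventually_nhds_iff_ball.mp hev
    have hv : 0 < volume.real (Metric.ball xs r) :=
      ENNReal.toReal_pos (Metric.measure_ball_pos volume xs hr).ne' measure_ball_lt_top.ne
    refine ⟨volume.real (Metric.ball xs r) / D, by positivity, ?_⟩
    intro N hN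
    have hsub : Metric.ball xs r ⊆ QQ := fun x hx => (hball x hx).2
    calc _ = ∫ x in Metric.ball xs r, N / D * Real.exp (N * (Φ - ε)) := by
            rw [setIntegral_const, smul_eq_mul]; field_simp
      _ ≤ ∫ x in Metric.ball xs r, N / D * Real.exp (N * PhiX hA hB hAB α x) := by
            refine setIntegral_mono_on (integrableOn_const measure_ball_lt_top.ne)
              ((hFi N hN).mono_set hsub) measurableSet_ball ?_
            intro x hx
            have := (hball x hx).1.le
            gcongr
      _ ≤ _ := setIntegral_mono_set (hFi N hN)
            (Eventually.of_forall fun x => by simp only [Pi.zero_apply]; positivity)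
            (LE.le.eventuallyLE hsub)
  have hposZ : ∀ N : ℕ, 0 < N → 0 < ∫ x in QQ, N / D * Real.exp (N * PhiX hA hB hAB α x) := by
    intro N hN
    obtain ⟨v, hv, h⟩ := hlower 1 one_pos
    have hN' : (0 : ℝ) < N := by exact_mod_cast hN
    exact lt_of_lt_of_le (by positivity) (h N hN)
  obtain ⟨r, rfl⟩ := hαQ
  have hr0 : 0 < r := by exact_mod_cast hα.1
  have hgood : ∀ M : ℕ, ∃ m : ℕ, (m : ℝ) = (r : ℝ) * ((r.den * M : ℕ) : ℝ) := by
    intro M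
    refine ⟨r.num.toNat * M, ?_⟩
    have h1 : ((r.num.toNat : ℕ) : ℤ) = r.num := Int.toNat_of_nonneg (Rat.num_nonneg.mpr hr0.le)
    have h2 : ((r.num.toNat : ℕ) : ℝ) = (r.num : ℝ) := by exact_mod_cast h1
    have h3 : (r : ℝ) * r.den = r.num := by exact_mod_cast Rat.mul_den_eq_num r
    push_cast
    rw [h2, ← h3]
    ring
  apply csSup_eq_of_forall_le_of_forall_lt_exists_gt
  · exact ⟨_, r.den * 1, by simpa using r.den_pos, hgood 1, rfl⟩
  · rintro y ⟨N, hN, hm, rfl⟩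
    have hN' : (0 : ℝ) < N := by exact_mod_cast hN
    rw [Zstar_eq hA hB hAB hd N hN _ hα hm, inv_mul_le_iff₀ hN',
      Real.log_le_iff_le_exp (hposZ N hN)]
    exact hupper N hN
  · intro w hw
    obtain ⟨v, hv, hlow⟩ := hlower ((Φ - w) / 2) (by linarith)
    have ht : Tendsto (fun N : ℕ => (N : ℝ)⁻¹ * Real.log v) atTop (𝓝 0) := by
      have := (tendsto_inv_atTop_nhds_zero_nat (𝕜 := ℝ)).mul_const (Real.log v)
      simpa using this
    have hev := ht.eventually_const_lt (show -((Φ - w) / 2) < 0 by linarith)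
    obtain ⟨N0, hN0⟩ := eventually_atTop.mp hev
    set N := r.den * (N0 + 1) with hNdef
    have hN : 0 < N := by have := r.den_pos; positivity
    have hNN : N0 ≤ N := by have := r.den_pos; nlinarith
    have hN' : (0 : ℝ) < N := by exact_mod_cast hN
    have hN1 : (1 : ℝ) ≤ N := by exact_mod_cast hN
    refine ⟨_, ⟨N, hN, hgood (N0 + 1), rfl⟩, ?_⟩
    rw [Zstar_eq hA hB hAB hd N hN _ hα (hgood (N0 + 1))]
    have h1 := Real.log_le_log (by positivity) (hlow N hN)
    rw [Real.log_mul (by positivity) (by positivity), Real.log_mul (by positivity) (by positivity),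
      Real.log_exp] at h1
    have h2 := Real.log_nonneg hN1
    have h3 := hN0 N hNN
    have h4 : (N : ℝ)⁻¹ * (Real.log v + N * (Φ - (Φ - w) / 2)) ≤
        (N : ℝ)⁻¹ * Real.log (∫ x in QQ, N / D * Real.exp (N * PhiX hA hB hAB r x)) :=
      mul_le_mul_of_nonneg_left (by linarith) (by positivity)
    have h5 : (N : ℝ)⁻¹ * (Real.log v + N * (Φ - (Φ - w) / 2)) =
        (N : ℝ)⁻¹ * Real.log v + (Φ - (Φ - w) / 2) := by field_simp
    rw [h5] at h4
    refine lt_of_lt_of_le ?_ h4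
    linarith
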